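/- Let q be a prime power and n ≥ 2. For x = (x_1, …, x_{n-1}) ∈ (F_q \ {0})^{n-1}, let F_0(x) = x_1 x_2 ⋯ x_{n-1} and F(x) = (1, F_0(x), x_1 F_0(x), x_2 F_0(x), …, x_{n-1} F_0(x)) ∈ F_q^{n+1}, and let X = { ⟨F(x)⟩ : x ∈ (F_q \ {0})^{n-1} } ⊆ PG(n, q). Then no line of PG(n, q) contains more than n points of X. -/

import Mathlib

/-- The vector `F(x) = (1, F₀(x), x₁ F₀(x), …, x_{n-1} F₀(x)) ∈ F^(n+1)`,
where `F₀(x) = x₁ x₂ ⋯ x_{n-1}`. -/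
def curveVec (F : Type) [Field F] (n : ℕ) (x : Fin (n - 1) → F) : Fin (n + 1) → F :=
  fun j =>
    if h0 : j.val = 0 then 1
    else if h1 : j.val = 1 then ∏ i, x i
    else x ⟨j.val - 2, by omega⟩ * ∏ i, x i

open Polynomial in
/-- If the `n`-th power of a polynomial of degree at most one equals a product of `n - 1` nonzero
polynomials of degree at most one, then all the polynomials involved are constant. -/
theorem natDegree_eq_zero_of_pow_eq_prod {F : Type*} [Field F] {n : ℕ} (hn : 1 ≤ n)
    {p : F[X]} {r : Fin (n - 1) → F[X]} (hr : ∀ i, r i ≠ 0) (hd : ∀ i, (r i).natDegree ≤ 1)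
    (h : p ^ n = ∏ i, r i) : p.natDegree = 0 ∧ ∀ i, (r i).natDegree = 0 := by
  have hdeg := congrArg natDegree h
  rw [natDegree_pow, natDegree_prod _ _ fun i _ => hr i] at hdeg
  have hle : ∑ i, (r i).natDegree ≤ n - 1 :=
    (Finset.sum_le_sum fun i _ => hd i).trans_eq (by simp)
  have hp : p.natDegree = 0 := by
    by_contra h0
    have := Nat.le_mul_of_pos_right n (Nat.pos_of_ne_zero h0)
    omega
  refine ⟨hp, fun i => ?_⟩
  rw [hp, mul_zero, eq_comm, Finset.sum_eq_zero_iff] at hdeg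
  exact hdeg i (Finset.mem_univ i)

/-- In a vector space of dimension two, the solutions of `φ v = 1` for a linear form `φ` with a
solution `a` lie on an affine line through `a`. -/
theorem exists_direction_of_finrank_eq_two {F V : Type*} [Field F] [AddCommGroup V] [Module F V]
    (hV : Module.finrank F V = 2) (φ : V →ₗ[F] F) {a : V} (ha : φ a = 1) :
    ∃ b : V, b ≠ 0 ∧ φ b = 0 ∧ ∀ v, φ v = 1 → ∃ s : F, v = a + s • b := by
  have : Module.Finite F V := Module.finite_of_finrank_eq_succ hV
  have hsurj : Function.Surjective φ := fun c => ⟨c • a, by simp [ha]⟩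
  have hker : Module.finrank F φ.ker = 1 := by
    have := φ.finrank_range_add_finrank_ker
    rw [LinearMap.range_eq_top.2 hsurj, finrank_top, Module.finrank_self, hV] at this
    omega
  obtain ⟨b, hb, hspan⟩ := finrank_eq_one_iff'.1 hker
  refine ⟨b, fun h => hb (Subtype.ext h), b.2, fun v hv => ?_⟩
  obtain ⟨s, hs⟩ := hspan ⟨v - a, by simp [hv, ha]⟩
  have hs' : s • (b : V) = v - a := congrArg Subtype.val hs
  exact ⟨s, by rw [hs', add_sub_cancel]⟩

section curveVec

variable {F : Type} [Field F] {n : ℕ}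

theorem curveVec_zero (x : Fin (n - 1) → F) : curveVec F n x 0 = 1 := by simp [curveVec]

theorem curveVec_one (hn : 1 < n + 1) (x : Fin (n - 1) → F) :
    curveVec F n x ⟨1, hn⟩ = ∏ i, x i := by simp [curveVec]

theorem curveVec_add_two (x : Fin (n - 1) → F) (i : Fin (n - 1)) :
    curveVec F n x ⟨i + 2, by omega⟩ = x i * ∏ j, x j := by simp [curveVec]

theorem curveVec_one_pow_eq_prod (hn : 1 < n + 1) (x : Fin (n - 1) → F) :
    curveVec F n x ⟨1, hn⟩ ^ n = ∏ i : Fin (n - 1), curveVec F n x ⟨i + 2, by omega⟩ := by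
  simp only [curveVec_one, curveVec_add_two, Finset.prod_mul_distrib, Finset.prod_const,
    Finset.card_univ, Fintype.card_fin]
  rw [← pow_succ', Nat.sub_add_cancel (by omega)]

open Polynomial in
/-- The line `A + s • B` through a point `A` of the curve meets the curve only at parameters `s`
that are roots of a nonzero polynomial of degree at most `n`. -/
theorem exists_polynomial_of_curveVec (hn : 1 < n + 1) {x₀ : Fin (n - 1) → F}
    (hx₀ : ∀ i, x₀ i ≠ 0) {B : Fin (n + 1) → F} (hB : B ≠ 0) (hB0 : B 0 = 0) :
    ∃ p : F[X], p ≠ 0 ∧ p.natDegree ≤ n ∧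
      ∀ x s, curveVec F n x = curveVec F n x₀ + s • B → p.IsRoot s := by
  let L (j : Fin (n + 1)) : F[X] := C (B j) * X + C (curveVec F n x₀ j)
  have hLd (j) : (L j).natDegree ≤ 1 := natDegree_linear_le
  have hL0 (j) (h : (L j).natDegree = 0) : B j = 0 := by
    have : (L j).coeff 1 = 0 := coeff_eq_zero_of_natDegree_lt (by omega)
    simpa [L] using this
  have heval (j s) : (L j).eval s = (curveVec F n x₀ + s • B) j := by
    simp only [L, eval_add, eval_mul, eval_C, eval_X, Pi.add_apply, Pi.smul_apply, smul_eq_mul]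
    ring
  have hi (i : Fin (n - 1)) : (i : ℕ) + 2 < n + 1 := by omega
  have hLne (i : Fin (n - 1)) : L ⟨i + 2, hi i⟩ ≠ 0 := fun h => by
    have := heval ⟨i + 2, hi i⟩ 0
    rw [h, eval_zero, zero_smul, add_zero, curveVec_add_two] at this
    exact mul_ne_zero (hx₀ i) (Finset.prod_ne_zero_iff.2 fun j _ => hx₀ j) this.symm
  refine ⟨L ⟨1, hn⟩ ^ n - ∏ i : Fin (n - 1), L ⟨i + 2, hi i⟩, fun h => hB ?_, ?_,
    fun x s hs => ?_⟩
  · obtain ⟨h1, h2⟩ := natDegree_eq_zero_of_pow_eq_prod (by omega) hLne (fun _ => hLd _)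
      (sub_eq_zero.1 h)
    funext ⟨j, hj⟩
    match j, hj with
    | 0, _ => exact hB0
    | 1, _ => exact hL0 _ h1
    | k + 2, hk => exact hL0 _ (h2 ⟨k, by omega⟩)
  · refine natDegree_sub_le_of_le ?_ ?_ |>.trans_eq (max_self n)
    · exact natDegree_pow_le.trans (by simpa using Nat.mul_le_mul_left n (hLd _))
    · refine (natDegree_prod_le _ _).trans ((Finset.sum_le_sum fun i _ => hLd _).trans ?_)
      simp
  · simp only [IsRoot, eval_sub, eval_pow, eval_prod, heval, ← hs]
    rw [curveVec_one_pow_eq_prod, sub_self]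

end curveVec

theorem curve_at_most_n_on_a_line (q n : ℕ) (F : Type) [Field F] [Fintype F]
    (hF : Fintype.card F = q) (hn : 2 ≤ n)
    (X : Set (Submodule F (Fin (n + 1) → F)))
    (hX : X = (fun x => Submodule.span F {curveVec F n x}) ''
        {x : Fin (n - 1) → F | ∀ i, x i ≠ 0}) :
    ∀ W : Submodule F (Fin (n + 1) → F), Module.finrank F W = 2 →
      {P ∈ X | P ≤ W}.ncard ≤ n := by
  classical
  intro W hW
  subst hX
  rcases Set.eq_empty_or_nonempty {P ∈ (fun x => Submodule.span F {curveVec F n x}) ''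
        {x : Fin (n - 1) → F | ∀ i, x i ≠ 0} | P ≤ W} with h | ⟨_, ⟨x₀, hx₀, rfl⟩, hW₀⟩
  · rw [h, Set.ncard_empty]
    exact n.zero_le
  have hA : curveVec F n x₀ ∈ W := (Submodule.span_singleton_le_iff_mem _ _).1 hW₀
  obtain ⟨⟨B, hBW⟩, hB, hB0, hline⟩ := exists_direction_of_finrank_eq_two hW
    ((LinearMap.proj 0).domRestrict W) (a := ⟨_, hA⟩) (curveVec_zero x₀)
  obtain ⟨p, hp, hpd, hroot⟩ := exists_polynomial_of_curveVec (by omega) hx₀ (fun h => hB (Subtype.ext h)) hB0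
  let f (s : F) : Submodule F (Fin (n + 1) → F) := Submodule.span F {curveVec F n x₀ + s • B}
  calc _ ≤ (p.roots.toFinset.image f : Set (Submodule F (Fin (n + 1) → F))).ncard := by
        refine Set.ncard_le_ncard ?_ (Finset.finite_toSet _)
        rintro _ ⟨⟨x, -, rfl⟩, hxW⟩
        obtain ⟨s, hs⟩ := hline ⟨_, (Submodule.span_singleton_le_iff_mem _ _).1 hxW⟩
          (curveVec_zero x)
        replace hs : curveVec F n x = curveVec F n x₀ + s • B := congrArg Subtype.val hs
        refine Finset.mem_coe.2 (Finset.mem_image.2 ⟨s, ?_, by simp only [f, hs]⟩)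
        exact Multiset.mem_toFinset.2 ((Polynomial.mem_roots hp).2 (hroot x s hs))
    _ ≤ p.roots.toFinset.card := by
        rw [Set.ncard_coe_finset]
        exact Finset.card_image_le
    _ ≤ p.natDegree := (Multiset.toFinset_card_le _).trans p.card_roots'
    _ ≤ n := hpd
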